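/- arXiv:2107.11603 — 2 statements merged into one kernel-verified Lean document; each statement's English description precedes it below -/
import Mathlib

section
/- Let A be a bounded normal operator on a complex Hilbert space and s ≥ 1 an integer. Then C_s(C_s(A)) ⊆ C_1(C_1(A)), i.e. any bounded operator B satisfying ad_X^s(B) = 0 for all X with ad_A^s(X) = 0 must commute with every operator commuting with A. -/
/-- The `s`-centralizer of a set of bounded operators. -/
def sCentralizer {H : Type*} [NormedAddCommGroup H] [InnerProductSpace ℂ H]
    [CompleteSpace H] (s : ℕ) (S : Set (H →L[ℂ] H)) : Set (H →L[ℂ] H) :=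
  {X | ∀ Y ∈ S, (fun Z => Y * Z - Z * Y)^[s] X = 0}

theorem ad_sq_unitary {R : Type*} [CStarAlgebra R] (U : unitary R) (B C : R)
    (hC : C = U * B - B * U) (h : (U : R) * C = C * U) : C = 0 := by
  have key : ∀ n : ℕ, (U : R) ^ (n + 1) * B
      = B * (U : R) ^ (n + 1) + ((n : ℂ) + 1) • (C * (U : R) ^ n) := by
    intro n
    induction n with
    | zero => simp [hC]
    | succ k ih =>
      have hUB : (U : R) * B = B * U + C := by rw [hC]; abel
      rw [pow_succ' _ (k + 1), mul_assoc, ih, mul_add, mul_smul_comm, ← mul_assoc, hUB,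
        ← mul_assoc (U : R) C, h, mul_assoc C, ← pow_succ']
      push_cast
      rw [add_mul, mul_assoc, add_smul ((k : ℂ) + 1), one_smul]
      abel
  have bound : ∀ n : ℕ, ((n : ℝ) + 1) * ‖C‖ ≤ 2 * ‖B‖ := by
    intro n
    have e : ((n : ℂ) + 1) • (C * (U : R) ^ n)
        = (U : R) ^ (n + 1) * B - B * (U : R) ^ (n + 1) := by rw [key]; abel
    have hn := congrArg norm e
    have c1 : ∀ (X : R) (m : ℕ), ‖X * (U : R) ^ m‖ = ‖X‖ := fun X m => by
      simpa using CStarRing.norm_mul_coe_unitary X (U ^ m)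
    have c2 : ∀ (X : R) (m : ℕ), ‖(U : R) ^ m * X‖ = ‖X‖ := fun X m => by
      simpa using CStarRing.norm_coe_unitary_mul (U ^ m) X
    have c3 : ‖((n : ℂ) + 1)‖ = (n : ℝ) + 1 := by
      have := Complex.norm_natCast (n + 1)
      push_cast at this
      exact this
    rw [norm_smul, c1, c3] at hn
    rw [hn]
    refine (norm_sub_le _ _).trans ?_
    rw [c1, c2]; linarith
  by_contra hne
  have hpos : 0 < ‖C‖ := norm_pos_iff.mpr hne
  obtain ⟨n, hn⟩ := exists_nat_gt (2 * ‖B‖ / ‖C‖)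
  rw [div_lt_iff₀ hpos] at hn
  have := bound n
  nlinarith

theorem ad_iter_unitary {R : Type*} [CStarAlgebra R] (U : unitary R) (s : ℕ) (B : R)
    (h : (fun Z => (U : R) * Z - Z * U)^[s + 1] B = 0) : (U : R) * B - B * U = 0 := by
  induction s generalizing B with
  | zero => simpa using h
  | succ k ih =>
    rw [Function.iterate_succ_apply] at h
    have := ih _ h
    exact ad_sq_unitary U B _ rfl (sub_eq_zero.mp this)

theorem stmt9 {H : Type*} [NormedAddCommGroup H] [InnerProductSpace ℂ H]
    [CompleteSpace H] (A : H →L[ℂ] H) (hA : A * star A = star A * A)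
    (s : ℕ) (hs : 1 ≤ s) :
    sCentralizer s (sCentralizer s {A}) ⊆ sCentralizer 1 (sCentralizer 1 {A}) := by
  obtain ⟨s, rfl⟩ : ∃ k, s = k + 1 := ⟨s - 1, by omega⟩
  intro B hB X hX
  have hX' : A * X - X * A = 0 := by simpa using hX A rfl
  have hAn : IsStarNormal A := ⟨hA.symm⟩
  have hcl : IsClosed ((StarSubalgebra.centralizer ℂ {A} : StarSubalgebra ℂ (H →L[ℂ] H)) :
      Set (H →L[ℂ] H)) := Set.isClosed_centralizer _
  have hXm : X ∈ StarSubalgebra.centralizer ℂ {A} := by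
    rw [StarSubalgebra.mem_centralizer_iff]
    rintro g rfl
    exact ⟨sub_eq_zero.mp hX', (hAn.commute_star_left (sub_eq_zero.mp hX')).eq⟩
  obtain ⟨u, c, hsum, -⟩ := CStarAlgebra.exists_sum_four_unitary
    (⟨X, hXm⟩ : StarSubalgebra.centralizer ℂ {A})
  have hcomm : ∀ i, ((u i : StarSubalgebra.centralizer ℂ {A}) : H →L[ℂ] H) * B
      = B * ((u i : StarSubalgebra.centralizer ℂ {A}) : H →L[ℂ] H) := by
    intro i
    set v : H →L[ℂ] H := ((u i : StarSubalgebra.centralizer ℂ {A}) : H →L[ℂ] H) with hv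
    have hvu : v ∈ unitary (H →L[ℂ] H) := by
      have := (u i).2
      rw [Unitary.mem_iff] at this ⊢
      exact ⟨congrArg Subtype.val this.1, congrArg Subtype.val this.2⟩
    have hvm : v ∈ sCentralizer (s + 1) {A} := by
      rintro Y rfl
      have h1 := ((StarSubalgebra.mem_centralizer_iff ℂ).mp
        (u i : StarSubalgebra.centralizer ℂ {Y}).2 Y rfl).1
      rw [Function.iterate_succ_apply]
      have h2 : Y * v - v * Y = 0 := sub_eq_zero.mpr h1
      simp only [h2]
      exact Function.iterate_fixed (by simp) s
    exact sub_eq_zero.mp (ad_iter_unitary ⟨v, hvu⟩ s B (hB v hvm))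
  have hXe : X = ∑ i, c i • ((u i : StarSubalgebra.centralizer ℂ {A}) : H →L[ℂ] H) := by
    have := congrArg Subtype.val hsum
    simpa using this
  simp only [Function.iterate_one]
  rw [hXe, Finset.sum_mul, Finset.mul_sum, sub_eq_zero]
  refine Finset.sum_congr rfl fun i _ => ?_
  rw [smul_mul_assoc, hcomm, mul_smul_comm]
end

section
/- For an n × n complex matrix A and a positive integer s, if B is an n × n complex matrix such that ad_X^s(B) = 0 for every n × n matrix X with ad_A^s(X) = 0, then B is a polynomial in A with complex coefficients. -/
open Polynomial in
lemma aux_comm_of_ss {V : Type*} [AddCommGroup V] [Module ℂ V] [FiniteDimensional ℂ V]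
    (x b : Module.End ℂ V) (p : ℂ[X]) (hp : Squarefree p) (hx : aeval x p = 0) (s : ℕ)
    (h : (fun Z => x * Z - Z * x)^[s] b = 0) : x * b = b * x := by
  rcases Nat.eq_zero_or_pos s with rfl | hs
  · simp at h; simp [h]
  have hL : Module.End.IsSemisimple (LinearMap.mulLeft ℂ x) := by
    apply Module.End.isSemisimple_of_squarefree_aeval_eq_zero hp
    have : aeval (Algebra.lmul ℂ (Module.End ℂ V) x) p = 0 := by
      rw [aeval_algHom_apply, hx, map_zero]
    exact this
  have key : ∀ q : ℂ[X], ∀ z, aeval (LinearMap.mulRight ℂ x) q z = z * aeval x q := by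
    intro q
    induction q using Polynomial.induction_on' with
    | add p q hp hq => intro z; simp [hp, hq, mul_add]
    | monomial n c => 
      intro z
      rw [aeval_monomial, aeval_monomial]
      simp [LinearMap.pow_mulRight, Algebra.algebraMap_eq_smul_one]
  have hR : Module.End.IsSemisimple (LinearMap.mulRight ℂ x) := by
    apply Module.End.isSemisimple_of_squarefree_aeval_eq_zero hp
    refine LinearMap.ext fun z => ?_
    rw [key, hx]; simp
  have hLR := hL.sub_of_commute (LinearMap.commute_mulLeft_right x x) hR
  set T : Module.End ℂ (Module.End ℂ V) := LinearMap.mulLeft ℂ x - LinearMap.mulRight ℂ x with hT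
  have e := hLR.isFinitelySemisimple.genEigenspace_eq_eigenspace 0 (k := (s : ℕ∞)) (by exact_mod_cast hs)
  have hb : b ∈ T.genEigenspace 0 s := by
    rw [Module.End.mem_genEigenspace_nat]
    simp only [zero_smul, sub_zero, LinearMap.mem_ker, Module.End.pow_apply]
    exact h
  rw [e, Module.End.mem_eigenspace_iff] at hb
  simp [hT, sub_eq_zero] at hb
  exact hb

lemma aux_DY {E : Type*} [Ring E] (D Y : E) (h : D * Y = Y * D + 1) (k : ℕ) :
    D ^ k * (Y * D) = Y * D ^ (k+1) + k * D ^ k := by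
  induction k with
  | zero => simp
  | succ k ih =>
    rw [pow_succ D k]
    calc D ^ k * D * (Y * D) = D ^ k * (D * Y) * D := by noncomm_ring
      _ = (D ^ k * (Y * D)) * D + D ^ k * D := by rw [h]; noncomm_ring
      _ = _ := by rw [ih]; push_cast; simp only [pow_succ, add_mul, mul_assoc, one_mul]; abel

lemma aux_DY2 {E : Type*} [Ring E] (D Y : E) (h : D * Y = Y * D + 1) (k : ℕ) :
    (Y * D) * Y ^ k = Y ^ k * (Y * D + k) := by
  induction k with
  | zero => simp
  | succ k ih =>
    rw [pow_succ Y k, ← mul_assoc, ih]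
    have : (k:E) * Y = Y * k := (Nat.cast_commute k Y).eq
    rw [mul_assoc, mul_assoc, add_mul, mul_assoc, h, this]
    push_cast; noncomm_ring

open Polynomial in
noncomputable def auxP (k : ℕ) : ℂ[X] := ∏ j ∈ Finset.range k, (X - C (j : ℂ))

open Polynomial in
lemma auxP_sqf (k : ℕ) : Squarefree (auxP k) := by
  apply Separable.squarefree
  unfold auxP
  rw [separable_prod_X_sub_C_iff']
  intro x _ y _ h
  exact_mod_cast h

open Polynomial in
lemma auxP_aeval {E : Type*} [Ring E] [Algebra ℂ E] (D Y : E) (h : D * Y = Y * D + 1) (k : ℕ) :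
    aeval (Y * D) (auxP k) = Y ^ k * D ^ k := by
  induction k with
  | zero => simp [auxP]
  | succ k ih =>
    have : auxP (k+1) = auxP k * (X - C (k:ℂ)) := by
      simp [auxP, Finset.prod_range_succ]
    rw [this, map_mul, ih, map_sub, aeval_X, aeval_C, map_natCast, mul_assoc, mul_sub,
      aux_DY D Y h, (Nat.cast_commute k (D^k)).eq]
    simp [pow_succ, mul_assoc]

open Polynomial in
lemma aux_H {Q : Type*} [AddCommGroup Q] [Module ℂ Q] [Module ℂ[X] Q] [IsScalarTower ℂ ℂ[X] Q]
    (a : ℂ) (k : ℕ) (mk : ℂ[X] →ₗ[ℂ[X]] Q) (hmk : Function.Surjective mk)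
    (hker : LinearMap.ker mk = Ideal.span {(X - C a) ^ k}) (D : Module.End ℂ ℂ[X])
    (hD : ∀ f, D ((X - C a) * f) = (X - C a) * D f + f) :
    ∃ H : Module.End ℂ Q, (∀ f : ℂ[X], H (mk f) = mk ((X - C a) * D f)) ∧
      aeval H (auxP (k + 1)) = 0 := by
  set I : Ideal ℂ[X] := Ideal.span {(X - C a) ^ k} with hI
  set Y : Module.End ℂ ℂ[X] := LinearMap.mulLeft ℂ (X - C a) with hY
  have hDY : D * Y = Y * D + 1 := by
    refine LinearMap.ext fun f => ?_; exact hD f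
  have hYk : ∀ m f, (Y ^ m) f = (X - C a) ^ m * f := by
    intro m f; rw [hY, LinearMap.pow_mulLeft]; rfl
  let mk' : ℂ[X] →ₗ[ℂ] Q := mk.restrictScalars ℂ
  have hpres : LinearMap.ker mk' ≤ LinearMap.ker (mk' ∘ₗ (Y * D)) := by
    intro f hf
    have hf' : f ∈ I := by rw [← hker]; exact hf
    show (Y * D) f ∈ LinearMap.ker mk
    rw [hker]
    rw [hI, Ideal.mem_span_singleton'] at hf'
    obtain ⟨g, rfl⟩ := hf'
    have : (Y * D) (g * (X - C a) ^ k) = ((Y * D) * Y ^ k) g := by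
      rw [Module.End.mul_apply (Y * D), hYk, mul_comm]
    rw [this, aux_DY2 D Y hDY, Module.End.mul_apply, hYk]
    exact Ideal.mul_mem_right _ _ (Ideal.mem_span_singleton_self _)
  let H : Module.End ℂ Q := (LinearMap.ker mk').liftQ (mk' ∘ₗ (Y * D)) hpres ∘ₗ
    (mk'.quotKerEquivOfSurjective hmk).symm.toLinearMap
  have hH : ∀ f : ℂ[X], H (mk f) = mk ((Y * D) f) := by
    intro f
    have : (mk'.quotKerEquivOfSurjective hmk).symm (mk f) = Submodule.Quotient.mk f := by
      rw [LinearEquiv.symm_apply_eq]; rfl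
    show (LinearMap.ker mk').liftQ (mk' ∘ₗ (Y * D)) hpres
      ((mk'.quotKerEquivOfSurjective hmk).symm (mk f)) = _
    rw [this]; rfl
  have hC : ∀ (c : ℂ) f, c • mk f = mk (c • f) := fun c f => (mk'.map_smul c f).symm
  refine ⟨H, hH, ?_⟩
  have hp : ∀ (p : ℂ[X]) (f : ℂ[X]), aeval H p (mk f) = mk (aeval (Y * D) p f) := by
    intro p
    induction p using Polynomial.induction_on with
    | C c => intro f; simp only [aeval_C, Module.algebraMap_end_apply, hC]
    | add p q hp hq => intro f; simp only [map_add, LinearMap.add_apply, hp, hq]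
    | monomial n c ih =>
      intro f
      rw [pow_succ, ← mul_assoc, map_mul (aeval H) (C c * X ^ n) X,
        map_mul (aeval (Y * D)) (C c * X ^ n) X, Module.End.mul_apply, Module.End.mul_apply,
        aeval_X, aeval_X, hH, ih]
  refine LinearMap.ext fun z => ?_
  obtain ⟨f, rfl⟩ := hmk z
  rw [hp, auxP_aeval D Y hDY, LinearMap.zero_apply, ← LinearMap.mem_ker, hker,
    Module.End.mul_apply, hYk, pow_succ, mul_assoc]
  exact Ideal.mul_mem_right _ _ (Ideal.mem_span_singleton_self _)

open Polynomial in
lemma aux_embed {V W : Type*} [AddCommGroup V] [Module ℂ V] [AddCommGroup W] [Module ℂ W]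
    (i : W →ₗ[ℂ] V) (π : V →ₗ[ℂ] W) (hpi : ∀ w, π (i w) = w) (H : Module.End ℂ W) (k : ℕ)
    (hH : aeval H (auxP (k+1)) = 0) :
    aeval (i ∘ₗ H ∘ₗ π : Module.End ℂ V) (auxP (k+1)) = 0 := by
  set x : Module.End ℂ V := i ∘ₗ H ∘ₗ π with hx
  have hp : ∀ (p : ℂ[X]) (w : W), aeval x p (i w) = i (aeval H p w) := by
    intro p
    induction p using Polynomial.induction_on with
    | C c => intro f; simp [aeval_C]
    | add p q hp hq => intro f; simp [hp, hq]
    | monomial n c ih =>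
      intro f
      rw [pow_succ, ← mul_assoc, map_mul (aeval x) (C c * X ^ n) X,
        map_mul (aeval H) (C c * X ^ n) X, Module.End.mul_apply, Module.End.mul_apply,
        aeval_X, aeval_X, ← ih]
      simp [hx, hpi]
  obtain ⟨q, hq⟩ : ∃ q, auxP (k+1) = q * X := by
    unfold auxP
    rw [Finset.prod_range_succ']
    exact ⟨∏ j ∈ Finset.range k, (X - C ((j + 1 : ℕ) : ℂ)), by simp⟩
  refine LinearMap.ext fun m => ?_
  rw [hq, map_mul, Module.End.mul_apply, aeval_X]
  have : x m = i (H (π m)) := rfl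
  rw [this, hp]
  have h2 : aeval H q (H (π m)) = aeval H (auxP (k+1)) (π m) := by
    rw [hq, map_mul, Module.End.mul_apply, aeval_X]
  rw [h2, hH]; simp

open Polynomial in
lemma aux_idem_sqf : Squarefree (X * (X - 1) : ℂ[X]) := by
  have := auxP_sqf 2
  simpa [auxP, Finset.prod_range_succ] using this

lemma aux_iter {E : Type*} [Ring E] (a x : E) (s t : ℕ) (hst : t ≤ s)
    (h : (fun Z => a * Z - Z * a)^[t] x = 0) : (fun Z => a * Z - Z * a)^[s] x = 0 := by
  obtain ⟨r, rfl⟩ := Nat.exists_eq_add_of_le' hst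
  rw [Function.iterate_add_apply, h]
  exact Function.iterate_fixed (by simp) r

open Polynomial in
theorem aux_main {ι : Type*} [Fintype ι] (a : ι → ℂ) (e : ι → ℕ)
    {M : Type*} [AddCommGroup M] [Module ℂ M] [Module ℂ[X] M] [IsScalarTower ℂ ℂ[X] M]
    [FiniteDimensional ℂ M]
    {Q : ι → Type*} [∀ i, AddCommGroup (Q i)] [∀ i, Module ℂ (Q i)] [∀ i, Module ℂ[X] (Q i)]
    [∀ i, IsScalarTower ℂ ℂ[X] (Q i)]
    (mk : ∀ i, ℂ[X] →ₗ[ℂ[X]] Q i) (hmk : ∀ i, Function.Surjective (mk i))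
    (hker : ∀ i, LinearMap.ker (mk i) = Ideal.span {(X - C (a i)) ^ (e i)})
    (inc : ∀ i, Q i →ₗ[ℂ[X]] M) (pr : ∀ i, M →ₗ[ℂ[X]] Q i)
    (hpi : ∀ i w, pr i (inc i w) = w)
    (hpi' : ∀ i j w, i ≠ j → pr j (inc i w) = 0)
    (hsum : ∀ m : M, ∑ i, inc i (pr i m) = m)
    (A B : Module.End ℂ M)
    (hA : ∀ m, A m = (X : ℂ[X]) • m) (s : ℕ) (hs : 0 < s)
    (h : ∀ x, (fun Z => A * Z - Z * A)^[s] x = 0 → (fun Z => x * Z - Z * x)^[s] B = 0) :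
    ∃ q : ℂ[X], ∀ m, B m = q • m := by
  classical
  -- semisimple elements
  have hss : ∀ (x : Module.End ℂ M) (p : ℂ[X]), Squarefree p → aeval x p = 0 →
      (fun Z => A * Z - Z * A)^[s] x = 0 → ∀ m, x (B m) = B (x m) := by
    intro x p hp hx hAx m
    exact LinearMap.congr_fun (aux_comm_of_ss x B p hp hx s (h x hAx)) m
  have hlin : ∀ f : M →ₗ[ℂ[X]] M, (fun Z => A * Z - Z * A)^[s] (f.restrictScalars ℂ) = 0 := by
    intro f
    apply aux_iter _ _ s 1 hs
    refine LinearMap.ext fun m => ?_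
    have : A (f m) - f (A m) = 0 := by rw [hA, hA, map_smul, sub_self]
    exact this
  have hidem : ∀ f : M →ₗ[ℂ[X]] M, (∀ m, f (f m) = f m) → ∀ m, f (B m) = B (f m) := by
    intro f hf m
    refine hss (f.restrictScalars ℂ) _ aux_idem_sqf ?_ (hlin f) m
    refine LinearMap.ext fun m => ?_
    simp [hf]
  have hP : ∀ i m, inc i (pr i (B m)) = B (inc i (pr i m)) := by
    intro i m
    exact hidem (inc i ∘ₗ pr i) (by intro m; simp [hpi]) m
  have hF : ∀ i j, i ≠ j → ∀ g : Q i →ₗ[ℂ[X]] Q j, ∀ m,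
      inc j (g (pr i (B m))) = B (inc j (g (pr i m))) := by
    intro i j hij g m
    have h1 := hidem (inc i ∘ₗ pr i + inc j ∘ₗ g ∘ₗ pr i) (by
      intro m; simp [hpi, hpi' j i _ hij.symm]) m
    simp only [LinearMap.add_apply, LinearMap.comp_apply, map_add] at h1
    rw [hP] at h1
    exact add_left_cancel h1
  -- B commutes with A
  have hcomm : ∀ m, B ((X : ℂ[X]) • m) = (X : ℂ[X]) • B m := by
    rcases Nat.lt_or_ge s 2 with hs2 | hs2
    · have hs1 : s = 1 := by omega
      subst hs1
      intro m
      have h1 := h A (by simp)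
      have h2 : A (B m) - B (A m) = 0 := LinearMap.congr_fun h1 m
      rw [hA, hA] at h2
      exact (sub_eq_zero.mp h2).symm
    have hH : ∀ i (H : Module.End ℂ (Q i)) (D : Module.End ℂ ℂ[X]),
        (∀ f, D ((X - C (a i)) * f) = (X - C (a i)) * D f + f) →
        (∀ f : ℂ[X], H (mk i f) = mk i ((X - C (a i)) * D f)) →
        aeval H (auxP (e i + 1)) = 0 →
        ∀ m, inc i (H (pr i (B m))) = B (inc i (H (pr i m))) := by
      intro i H D hD hH hp m
      have hXH : ∀ w, H ((X : ℂ[X]) • w) = (X : ℂ[X]) • H w + (X - C (a i)) • w := by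
        intro w
        obtain ⟨f, rfl⟩ := hmk _ w
        have e1 : (X : ℂ[X]) * f = (X - C (a i)) * f + a i • f := by
          rw [smul_eq_C_mul]; ring
        have e2 : D (X * f) = X * D f + f := by
          rw [e1, map_add, hD, map_smul, smul_eq_C_mul]; ring
        rw [← map_smul (mk _), hH, hH, ← map_smul (mk _),
          ← map_smul (mk _), ← map_add (mk _), smul_eq_mul, e2]
        congr 1
        simp only [smul_eq_mul]; ring
      refine hss ((inc i).restrictScalars ℂ ∘ₗ H ∘ₗ (pr i).restrictScalars ℂ) _
        (auxP_sqf (e i + 1)) (aux_embed _ _ (hpi i) H _ hp) ?_ m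
      apply aux_iter _ _ s 2 hs2
      have e1 : (fun Z => A * Z - Z * A)
          ((inc i).restrictScalars ℂ ∘ₗ H ∘ₗ (pr i).restrictScalars ℂ) =
          (-((inc i) ∘ₗ ((X - C (a i)) • pr i))).restrictScalars ℂ := by
        refine LinearMap.ext fun m => ?_
        have : A (inc i (H (pr i m))) - inc i (H (pr i (A m))) =
            - inc i ((X - C (a i)) • pr i m) := by
          rw [hA, hA, map_smul (pr i), hXH, map_add, map_smul]; abel
        exact this
      rw [Function.iterate_succ_apply]
      refine (congrArg _ e1).trans ?_
      refine LinearMap.ext fun m => ?_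
      set f := (-((inc i) ∘ₗ ((X - C (a i)) • pr i)))
      have : A (f m) - f (A m) = 0 := by rw [hA, hA, map_smul, sub_self]
      exact this
    have hY : ∀ i m, inc i ((X : ℂ[X]) • (pr i (B m))) = B (inc i ((X : ℂ[X]) • (pr i m))) := by
      intro i m
      have hD1 : ∀ f, (derivative : Module.End ℂ ℂ[X]) ((X - C (a i)) * f)
          = (X - C (a i)) * (derivative : Module.End ℂ ℂ[X]) f + f := by
        intro f; simp [derivative_mul]; ring
      have hD2 : ∀ f, ((derivative : Module.End ℂ ℂ[X]) + 1) ((X - C (a i)) * f)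
          = (X - C (a i)) * ((derivative : Module.End ℂ ℂ[X]) + 1) f + f := by
        intro f; simp [derivative_mul]; ring
      obtain ⟨H1, h1, h1'⟩ := aux_H (a i) (e i) (mk i) (hmk i) (hker i) _ hD1
      obtain ⟨H2, h2, h2'⟩ := aux_H (a i) (e i) (mk i) (hmk i) (hker i) _ hD2
      have c1 := hH i H1 _ hD1 h1 h1' m
      have c2 := hH i H2 _ hD2 h2 h2' m
      have hC : ∀ (c : ℂ) f, c • mk i f = mk i (c • f) :=
        fun c f => (((mk i).restrictScalars ℂ).map_smul c f).symm
      have h12 : ∀ w : Q i, H2 w = H1 w + ((X : ℂ[X]) • w - a i • w) := by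
        intro w
        obtain ⟨f, rfl⟩ := hmk _ w
        rw [h1, h2, hC, ← map_smul (mk _), ← map_sub (mk _), ← map_add (mk _)]
        congr 1
        simp only [LinearMap.add_apply, Module.End.one_apply, smul_eq_mul, smul_eq_C_mul]; ring
      have hsm : ∀ w : Q i, inc i (a i • w) = a i • inc i w := fun w =>
        ((inc i).restrictScalars ℂ).map_smul _ _
      rw [h12, h12] at c2
      simp only [map_add, map_sub] at c2
      rw [c1] at c2
      have c3 := add_left_cancel c2
      rw [hsm, hsm, map_smul B, hP] at c3
      exact sub_left_injective c3
    intro m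
    have e1 : (X : ℂ[X]) • m = ∑ i, inc i ((X : ℂ[X]) • pr i m) := by
      conv_lhs => rw [← hsum m]
      rw [Finset.smul_sum]; simp only [map_smul]
    have e2 : (X : ℂ[X]) • B m = ∑ i, inc i ((X : ℂ[X]) • pr i (B m)) := by
      conv_lhs => rw [← hsum (B m)]
      rw [Finset.smul_sum]; simp only [map_smul]
    rw [e1, e2, map_sum]
    exact Finset.sum_congr rfl fun i _ => (hY i m).symm
  have hBlin : ∀ (f : ℂ[X]) (m : M), B (f • m) = f • B m := by
    intro f
    induction f using Polynomial.induction_on with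
    | C c => 
      intro m
      have : ∀ m : M, (C c : ℂ[X]) • m = c • m := by
        intro m
        rw [← algebraMap_smul ℂ[X] c m]; rfl
      rw [this, this, map_smul]
    | add p q hp hq => intro m; rw [add_smul, add_smul, map_add, hp, hq]
    | monomial n c ih =>
      intro m
      rw [pow_succ, ← mul_assoc, mul_smul, ih, hcomm, smul_smul]
  have hq : ∀ i, ∃ q : ℂ[X], pr i (B (inc i (mk i 1))) = mk i (q) := by
    intro i
    obtain ⟨f, hf⟩ := hmk i (pr i (B (inc i (mk i 1))))
    exact ⟨f, hf.symm⟩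
  choose q hq using hq
  have hBi : ∀ i (w : Q i), B (inc i w) = inc i (q i • w) := by
    intro i w
    obtain ⟨f, rfl⟩ := hmk _ w
    have e1 : mk i f = f • mk i 1 := by
      rw [← map_smul (mk _)]; simp
    have e2 := hP i (inc i (mk i 1))
    rw [hpi, hq] at e2
    rw [e1, map_smul, hBlin, ← e2, ← map_smul, ← map_smul (mk _),
      ← map_smul (mk _), ← map_smul (mk _)]
    congr 2
    simp [mul_comm]
  have hqq : ∀ i j, a i = a j → e j ≤ e i →
      q i - q j ∈ Ideal.span {(X - C (a j)) ^ (e j)} := by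
    intro i j haij heij
    by_cases hij : i = j
    · subst hij; simp
    have hle : Ideal.span {(X - C (a i)) ^ (e i)} ≤ Ideal.span {(X - C (a j)) ^ (e j)} := by
      rw [Ideal.span_singleton_le_span_singleton, haij]
      exact pow_dvd_pow _ heij
    obtain ⟨g, hg⟩ : ∃ g : Q i →ₗ[ℂ[X]] Q j, ∀ f, g (mk i f) = mk j f := by
      refine ⟨(LinearMap.ker (mk i)).liftQ (mk j) (by rw [hker, hker]; exact hle) ∘ₗ
        ((mk i).quotKerEquivOfSurjective (hmk i)).symm.toLinearMap, fun f => ?_⟩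
      have : ((mk i).quotKerEquivOfSurjective (hmk i)).symm (mk i f) = Submodule.Quotient.mk f := by
        rw [LinearEquiv.symm_apply_eq]; rfl
      rw [LinearMap.comp_apply, LinearEquiv.coe_coe, this]; rfl
    have c := hF i j hij g (inc i (mk i 1))
    rw [hBi, hpi, hpi, hg, hBi, map_smul, hg] at c
    have c' := congrArg (pr j) c
    rw [hpi, hpi, ← map_smul (mk _), ← map_smul (mk _),
      ← sub_eq_zero, ← map_sub, ← LinearMap.mem_ker, hker] at c'
    simpa using c'
  have hmax : ∀ α : Set.range a, ∃ i, a i = α ∧ ∀ j, a j = α → e j ≤ e i := by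
    rintro ⟨_, i0, rfl⟩
    obtain ⟨i, hi, hm⟩ := Finset.exists_max_image (Finset.univ.filter fun i => a i = a i0) e
      ⟨i0, by simp⟩
    exact ⟨i, by simpa using hi, fun j hj => hm j (by simpa using hj)⟩
  choose t ht ht' using hmax
  obtain ⟨r, hr⟩ := Ideal.exists_forall_sub_mem_ideal
    (I := fun α : Set.range a => Ideal.span {(X - C (α : ℂ)) ^ (e (t α))}) (by
      intro α β hαβ
      show IsCoprime (Ideal.span _) (Ideal.span _)
      rw [Ideal.isCoprime_span_singleton_iff]
      apply IsCoprime.pow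
      exact pairwise_coprime_X_sub_C Subtype.val_injective hαβ) (fun α => q (t α))
  refine ⟨r, fun m => ?_⟩
  have hrj : ∀ j (w : Q j), q j • w = r • w := by
    intro j w
    obtain ⟨f, rfl⟩ := hmk _ w
    rw [← map_smul (mk _), ← map_smul (mk _), ← sub_eq_zero, ← map_sub (mk _), ← LinearMap.mem_ker, hker,
      ← sub_smul, smul_eq_mul]
    apply Ideal.mul_mem_right
    let α : Set.range a := ⟨a j, j, rfl⟩
    have h1 := hqq (t α) j (ht α) (ht' α j rfl)
    have h2 := hr α
    have h3 : r - q (t α) ∈ Ideal.span {(X - C (a j)) ^ (e j)} := by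
      refine (Ideal.span_singleton_le_span_singleton.mpr ?_) h2
      exact pow_dvd_pow _ (ht' α j rfl)
    have := Ideal.add_mem _ h3 h1
    rw [← Ideal.neg_mem_iff]
    convert this using 1
    ring
  calc B m = ∑ i, B (inc i (pr i m)) := by rw [← map_sum, hsum]
    _ = ∑ i, r • inc i (pr i m) := Finset.sum_congr rfl fun i _ => by
        rw [hBi, hrj, map_smul]
    _ = r • m := by rw [← Finset.smul_sum, hsum]

open Polynomial in
lemma aux_aeval {M : Type*} [AddCommGroup M] [Module ℂ M] [Module ℂ[X] M] [IsScalarTower ℂ ℂ[X] M]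
    (A : Module.End ℂ M) (hA : ∀ m, A m = (X : ℂ[X]) • m) (q : ℂ[X]) :
    ∀ m, aeval A q m = q • m := by
  induction q using Polynomial.induction_on with
  | C c =>
    intro m
    rw [aeval_C, Module.algebraMap_end_apply, ← algebraMap_smul ℂ[X] c m]; rfl
  | add p q hp hq => intro m; rw [add_smul, map_add, LinearMap.add_apply, hp, hq]
  | monomial n c ih =>
    intro m
    rw [pow_succ, ← mul_assoc, mul_smul, map_mul (aeval A) (C c * X ^ n) X, Module.End.mul_apply,
      aeval_X, hA, ih]

open Polynomial in
theorem stmt19 (n : ℕ) (A B : Matrix (Fin n) (Fin n) ℂ) (s : ℕ) (hs : 0 < s)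
    (h : ∀ X : Matrix (Fin n) (Fin n) ℂ, (fun Z => A * Z - Z * A)^[s] X = 0 →
      (fun Z => X * Z - Z * X)^[s] B = 0) :
    ∃ p : Polynomial ℂ, B = Polynomial.aeval A p := by
  classical
  let T : Module.End ℂ (Fin n → ℂ) := Matrix.toLinAlgEquiv' A
  obtain ⟨ι, _, p, hp, e, ⟨φ⟩⟩ := Module.equiv_directSum_of_isTorsion
    (R := ℂ[X]) (M := Module.AEval' T) (Module.AEval.isTorsion_of_finiteDimensional ℂ (Fin n → ℂ) T)
  have hroot : ∀ i, ∃ α : ℂ, Ideal.span {p i ^ e i} = Ideal.span {(X - C α) ^ e i} := by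
    intro i
    obtain ⟨α, hα⟩ := IsAlgClosed.exists_root (p i)
      (by have := (hp i).degree_pos; exact this.ne')
    refine ⟨α, ?_⟩
    rw [Ideal.span_singleton_eq_span_singleton]
    apply Associated.pow_pow
    exact ((irreducible_X_sub_C α).associated_of_dvd (hp i) (dvd_iff_isRoot.mpr hα)).symm
  choose a ha using hroot
  have φ2 : Nonempty (Module.AEval' T ≃ₗ[ℂ[X]] ∀ i, ℂ[X] ⧸ Ideal.span {(X - C (a i)) ^ (e i)}) := by
    refine ⟨φ.trans ((DirectSum.linearEquivFunOnFintype ℂ[X] ι _).trans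
      (LinearEquiv.piCongrRight fun i => Submodule.quotEquivOfEq _ _ (ha i)))⟩
  obtain ⟨φ2⟩ := φ2
  let ψ : (Fin n → ℂ) ≃ₗ[ℂ] ∀ i, ℂ[X] ⧸ Ideal.span {(X - C (a i)) ^ (e i)} :=
    (Module.AEval'.of T).trans (φ2.restrictScalars ℂ)
  let Φ : Matrix (Fin n) (Fin n) ℂ ≃ₐ[ℂ] _ := Matrix.toLinAlgEquiv'.trans (ψ.conjAlgEquiv ℂ)
  have : FiniteDimensional ℂ (∀ i, ℂ[X] ⧸ Ideal.span {(X - C (a i)) ^ (e i)}) :=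
    Module.Finite.equiv ψ
  have hA : ∀ m, Φ A m = (X : ℂ[X]) • m := by
    intro m
    obtain ⟨v, rfl⟩ := ψ.surjective m
    have h1 : Φ A (ψ v) = ψ (T v) := by
      show ψ (T (ψ.symm (ψ v))) = _
      rw [ψ.symm_apply_apply]
    rw [h1]
    show φ2 (Module.AEval'.of T (T v)) = X • φ2 (Module.AEval'.of T v)
    rw [← map_smul, Module.AEval'.X_smul_of]
  have hit : ∀ (x y : Matrix (Fin n) (Fin n) ℂ), 
      Φ ((fun Z => x * Z - Z * x)^[s] y) = (fun Z => Φ x * Z - Z * Φ x)^[s] (Φ y) := by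
    intro x y
    have : Function.Semiconj Φ (fun Z => x * Z - Z * x) (fun Z => Φ x * Z - Z * Φ x) := by
      intro z; simp
    exact (this.iterate_right s) y
  obtain ⟨q, hq⟩ := aux_main a e (M := ∀ i, ℂ[X] ⧸ Ideal.span {(X - C (a i)) ^ (e i)})
    (Q := fun i => ℂ[X] ⧸ Ideal.span {(X - C (a i)) ^ (e i)})
    (fun i => Submodule.mkQ _) (fun i => Submodule.mkQ_surjective _)
    (fun i => Submodule.ker_mkQ _)
    (fun i => LinearMap.single ℂ[X] (fun i => ℂ[X] ⧸ Ideal.span {(X - C (a i)) ^ (e i)}) i) (fun i => LinearMap.proj i)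
    (fun i w => Pi.single_eq_same (M := fun i => ℂ[X] ⧸ Ideal.span {(X - C (a i)) ^ (e i)}) i w) (fun i j w hij => Pi.single_eq_of_ne (M := fun i => ℂ[X] ⧸ Ideal.span {(X - C (a i)) ^ (e i)}) hij.symm w)
    (fun m => Finset.univ_sum_single m) (Φ A) (Φ B) hA s hs (by
    intro x hx
    obtain ⟨x, rfl⟩ := Φ.surjective x
    rw [← hit] at hx ⊢
    rw [h x (by simpa using hx), map_zero])
  refine ⟨q, Φ.injective ?_⟩
  have e1 : Φ (aeval A q) = aeval (Φ A) q := (aeval_algHom_apply Φ A q).symm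
  rw [e1]
  refine LinearMap.ext fun m => ?_
  rw [hq]
  exact (aux_aeval (Φ A) hA q m).symm
end
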